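/- Suppose ε ∈ ℂ satisfies ε ≠ d_i for all i = 1,…,M and the secular equation ε = u + R(ε), where R(ε) = Σ_{i=1}^{M} (conj(β_i)·α_i + conj(α_i)·β_i)/(ε − d_i). Then the vector ψ ∈ ℂ^N with entries ψ_i = α_i/(ε − d_i) for 1 ≤ i ≤ M, ψ_{M+1} = 1, and ψ_{M+1+i} = β_i/(ε − d_i) for 1 ≤ i ≤ M satisfies H(d, α, β, u) · ψ = ε · ψ; in particular ε is an eigenvalue of H(d, α, β, u). -/

import Mathlib

open Matrix

/-- 1-based access to a vector indexed by `Fin M`: `get1 w n = w_{n}` for `1 ≤ n ≤ M`. -/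
def get1 {α : Type*} [Zero α] {M : ℕ} (w : Fin M → α) (n : ℕ) : α :=
  if h : n - 1 < M then w ⟨n - 1, h⟩ else 0

/-- The arrowhead-type matrix `H(d, α, β, u)` of size `N = 2M+1`, with `d ∈ ℝ^M`,
`α, β ∈ ℂ^M`, `u ∈ ℝ` (entries described with 1-based indices `a = i+1`, `b = j+1`). -/
def Hmat (M : ℕ) (d : Fin M → ℝ) (α β : Fin M → ℂ) (u : ℝ) :
    Matrix (Fin (2 * M + 1)) (Fin (2 * M + 1)) ℂ :=
  Matrix.of fun i j =>
    if (i : ℕ) + 1 ≤ M ∧ (j : ℕ) = (i : ℕ) then (get1 d ((i : ℕ) + 1) : ℝ)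
    else if M + 2 ≤ (i : ℕ) + 1 ∧ (j : ℕ) = (i : ℕ) then (get1 d ((i : ℕ) + 1 - (M + 1)) : ℝ)
    else if (i : ℕ) + 1 = M + 1 ∧ (j : ℕ) + 1 = M + 1 then (u : ℂ)
    else if (i : ℕ) + 1 ≤ M ∧ (j : ℕ) + 1 = M + 1 then get1 α ((i : ℕ) + 1)
    else if (i : ℕ) + 1 = M + 1 ∧ (j : ℕ) + 1 ≤ M then star (get1 β ((j : ℕ) + 1))
    else if (i : ℕ) + 1 = M + 1 ∧ M + 2 ≤ (j : ℕ) + 1 then star (get1 α ((j : ℕ) + 1 - (M + 1)))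
    else if M + 2 ≤ (i : ℕ) + 1 ∧ (j : ℕ) + 1 = M + 1 then get1 β ((i : ℕ) + 1 - (M + 1))
    else 0

/-- The candidate eigenvector of `H(d, α, β, u)` associated with an energy `ε`
away from the `d_i`: entries `α_i/(ε - d_i)` (positions `1..M`), `1` (position
`M+1`), `β_i/(ε - d_i)` (positions `M+2..2M+1`). -/
noncomputable def psiVec (M : ℕ) (d : Fin M → ℝ) (α β : Fin M → ℂ) (ε : ℂ) :
    Fin (2 * M + 1) → ℂ :=
  fun i =>
    if h : (i : ℕ) < M then α ⟨(i : ℕ), h⟩ / (ε - (d ⟨(i : ℕ), h⟩ : ℂ))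
    else if h' : M + 1 ≤ (i : ℕ) then
      β ⟨(i : ℕ) - (M + 1), by have := i.isLt; omega⟩ /
        (ε - (d ⟨(i : ℕ) - (M + 1), by have := i.isLt; omega⟩ : ℂ))
    else 1

/-- The position of index `i` in the first block of size `M`. -/
def lowerIdx {M : ℕ} (i : Fin M) : Fin (2 * M + 1) := ⟨i, by omega⟩

/-- The position of the central site. -/
def centerIdx (M : ℕ) : Fin (2 * M + 1) := ⟨M, by omega⟩

/-- The position of index `i` in the last block of size `M`. -/
def upperIdx {M : ℕ} (i : Fin M) : Fin (2 * M + 1) := ⟨M + 1 + i, by omega⟩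

theorem exists_idx {M : ℕ} (k : Fin (2 * M + 1)) :
    (∃ i : Fin M, k = lowerIdx i) ∨ k = centerIdx M ∨ ∃ i : Fin M, k = upperIdx i := by
  rcases lt_trichotomy (k : ℕ) M with h | h | h
  · exact Or.inl ⟨⟨k, h⟩, rfl⟩
  · exact Or.inr (Or.inl (Fin.ext h))
  · exact Or.inr (Or.inr ⟨⟨k - (M + 1), by omega⟩, Fin.ext (by simp only [upperIdx]; omega)⟩)

theorem sum_blocks {A : Type*} [AddCommMonoid A] {M : ℕ} (f : Fin (2 * M + 1) → A) :
    ∑ k, f k = ∑ i : Fin M, f (lowerIdx i) + f (centerIdx M) + ∑ i : Fin M, f (upperIdx i) := by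
  rw [← (finCongr (by omega : M + 1 + M = 2 * M + 1)).sum_comp, Fin.sum_univ_add,
    Fin.sum_univ_castSucc]
  rfl

section Entries

variable {M : ℕ} (d : Fin M → ℝ) (α β : Fin M → ℂ) (u : ℝ) (ε : ℂ) (i j : Fin M)

theorem get1_succ {A : Type*} [Zero A] (w : Fin M → A) : get1 w ((i : ℕ) + 1) = w i := by
  simp [get1]

theorem Hmat_lower_lower :
    Hmat M d α β u (lowerIdx i) (lowerIdx j) = if j = i then (d i : ℂ) else 0 := by
  have hi := i.isLt
  have hj := j.isLt
  simp only [Hmat, Matrix.of_apply, lowerIdx, get1_succ, Fin.ext_iff]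
  split_ifs <;> first | rfl | grind

theorem Hmat_lower_center : Hmat M d α β u (lowerIdx i) (centerIdx M) = α i := by
  have hi := i.isLt
  simp only [Hmat, Matrix.of_apply, lowerIdx, centerIdx, get1_succ]
  split_ifs <;> first | rfl | grind

theorem Hmat_lower_upper : Hmat M d α β u (lowerIdx i) (upperIdx j) = 0 := by
  have hi := i.isLt
  simp only [Hmat, Matrix.of_apply, lowerIdx, upperIdx]
  split_ifs <;> first | rfl | grind

theorem Hmat_center_lower : Hmat M d α β u (centerIdx M) (lowerIdx j) = star (β j) := by
  have hj := j.isLt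
  simp only [Hmat, Matrix.of_apply, lowerIdx, centerIdx, get1_succ]
  split_ifs <;> first | rfl | grind

theorem Hmat_center_center : Hmat M d α β u (centerIdx M) (centerIdx M) = u := by
  simp [Hmat, centerIdx]

theorem upper_sub : M + 1 + (i : ℕ) + 1 - (M + 1) = i + 1 := by omega

theorem Hmat_center_upper : Hmat M d α β u (centerIdx M) (upperIdx j) = star (α j) := by
  simp only [Hmat, Matrix.of_apply, upperIdx, centerIdx, upper_sub, get1_succ]
  split_ifs <;> first | rfl | grind

theorem Hmat_upper_lower : Hmat M d α β u (upperIdx i) (lowerIdx j) = 0 := by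
  have hj := j.isLt
  simp only [Hmat, Matrix.of_apply, lowerIdx, upperIdx]
  split_ifs <;> first | rfl | grind

theorem Hmat_upper_center : Hmat M d α β u (upperIdx i) (centerIdx M) = β i := by
  simp only [Hmat, Matrix.of_apply, upperIdx, centerIdx, upper_sub, get1_succ]
  split_ifs <;> first | rfl | grind

theorem Hmat_upper_upper :
    Hmat M d α β u (upperIdx i) (upperIdx j) = if j = i then (d i : ℂ) else 0 := by
  simp only [Hmat, Matrix.of_apply, upperIdx, upper_sub, get1_succ, Fin.ext_iff]
  split_ifs <;> first | rfl | grind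

theorem psiVec_lower : psiVec M d α β ε (lowerIdx i) = α i / (ε - d i) := by
  simp [psiVec, lowerIdx]

theorem psiVec_center : psiVec M d α β ε (centerIdx M) = 1 := by
  simp [psiVec, centerIdx]

theorem psiVec_upper : psiVec M d α β ε (upperIdx i) = β i / (ε - d i) := by
  have h : ¬ M + 1 + (i : ℕ) < M := by omega
  simp [psiVec, upperIdx, h]

end Entries

/-- if `ε ≠ d_i` for all `i` and `ε` solves the secular equation
`ε = u + Σ_i (conj β_i · α_i + conj α_i · β_i)/(ε - d_i)`, then the above vector
`ψ` (with middle entry `1`, hence nonzero) satisfies `H ψ = ε ψ`; in particular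
`ε` is an eigenvalue of `H(d, α, β, u)`. -/
theorem statement7 (M : ℕ) (hM : 1 ≤ M) (d : Fin M → ℝ) (α β : Fin M → ℂ) (u : ℝ)
    (ε : ℂ) (hεd : ∀ i : Fin M, ε ≠ (d i : ℂ))
    (hsec : ε = (u : ℂ) + ∑ i : Fin M,
      (star (β i) * α i + star (α i) * β i) / (ε - (d i : ℂ))) :
    psiVec M d α β ε ≠ 0 ∧
    (Hmat M d α β u).mulVec (psiVec M d α β ε) = ε • psiVec M d α β ε := by
  refine ⟨fun h => one_ne_zero ((psiVec_center d α β ε).symm.trans (congrFun h _)), ?_⟩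
  funext k
  rw [Matrix.mulVec, dotProduct, sum_blocks, Pi.smul_apply, smul_eq_mul]
  rcases exists_idx k with ⟨i, rfl⟩ | rfl | ⟨i, rfl⟩
  · have := sub_ne_zero.mpr (hεd i)
    simp only [Hmat_lower_lower, Hmat_lower_center, Hmat_lower_upper, psiVec_lower, psiVec_center,
      ite_mul, zero_mul, Finset.sum_ite_eq', Finset.mem_univ, if_true, Finset.sum_const_zero]
    field_simp
    ring
  · simp only [Hmat_center_lower, Hmat_center_center, Hmat_center_upper, psiVec_lower,
      psiVec_center, psiVec_upper, mul_one]
    conv_rhs => rw [hsec]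
    simp only [add_div, Finset.sum_add_distrib, mul_div_assoc]
    ring
  · have := sub_ne_zero.mpr (hεd i)
    simp only [Hmat_upper_lower, Hmat_upper_center, Hmat_upper_upper, psiVec_upper, psiVec_center,
      ite_mul, zero_mul, Finset.sum_ite_eq', Finset.mem_univ, if_true, Finset.sum_const_zero]
    field_simp
    ring
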